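/- arXiv:1807.11739 — 3 statements merged into one kernel-verified Lean document; each statement's English description precedes it below -/
import Mathlib

section
/- Let Ω ⊆ ℝ^p be open, K ⊆ Ω compact, and m ∈ ℕ. Define, for f ∈ C^∞(Ω), the seminorm ρ_{K,m}(f) = 2^m · sup_{|α| ≤ m} sup_{x∈K} |∂_x^α f(x)|, where α ranges over multi-indices in ℕ^p with |α| = α_1 + … + α_p ≤ m. Then ρ_{K,m} is submultiplicative: for all f, g ∈ C^∞(Ω), ρ_{K,m}(f·g) ≤ ρ_{K,m}(f)·ρ_{K,m}(g). -/
/-- Iterated partial derivatives along a list of coordinate directions. -/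
noncomputable def derivAlong {n : ℕ} : List (Fin n) → ((Fin n → ℝ) → ℝ) → (Fin n → ℝ) → ℝ
  | [], f => f
  | i :: l, f => derivAlong l fun x => fderiv ℝ f x (Pi.single i 1)

/-- The iterated partial derivative `∂^α f` corresponding to a multi-index `α : Fin n → ℕ`. -/
noncomputable def multiDeriv {n : ℕ} (α : Fin n → ℕ) (f : (Fin n → ℝ) → ℝ) :
    (Fin n → ℝ) → ℝ :=
  derivAlong ((List.finRange n).flatMap fun i => List.replicate (α i) i) f

theorem derivAlong_congr {n : ℕ} {Ω : Set (Fin n → ℝ)} (hΩ : IsOpen Ω) (l : List (Fin n))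
    {f g : (Fin n → ℝ) → ℝ} (h : Set.EqOn f g Ω) :
    Set.EqOn (derivAlong l f) (derivAlong l g) Ω := by
  induction l generalizing f g with
  | nil => exact h
  | cons i l ih =>
    refine ih fun x hx => ?_
    have : f =ᶠ[nhds x] g := h.eventuallyEq_of_mem (hΩ.mem_nhds hx)
    simp only [this.fderiv_eq]

theorem ContDiffOn.fderiv_apply_const {n : ℕ} {Ω : Set (Fin n → ℝ)} (hΩ : IsOpen Ω)
    {f : (Fin n → ℝ) → ℝ} (hf : ContDiffOn ℝ (⊤ : ℕ∞) f Ω) (v : Fin n → ℝ) :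
    ContDiffOn ℝ (⊤ : ℕ∞) (fun x => fderiv ℝ f x v) Ω :=
  (hf.fderiv_of_isOpen hΩ (by simp)).clm_apply contDiffOn_const

theorem contDiffOn_derivAlong {n : ℕ} {Ω : Set (Fin n → ℝ)} (hΩ : IsOpen Ω) (l : List (Fin n))
    {f : (Fin n → ℝ) → ℝ} (hf : ContDiffOn ℝ (⊤ : ℕ∞) f Ω) :
    ContDiffOn ℝ (⊤ : ℕ∞) (derivAlong l f) Ω := by
  induction l generalizing f with
  | nil => exact hf
  | cons i l ih => exact ih (hf.fderiv_apply_const hΩ _)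

theorem derivAlong_add {n : ℕ} {Ω : Set (Fin n → ℝ)} (hΩ : IsOpen Ω) (l : List (Fin n))
    {f g : (Fin n → ℝ) → ℝ} (hf : ContDiffOn ℝ (⊤ : ℕ∞) f Ω)
    (hg : ContDiffOn ℝ (⊤ : ℕ∞) g Ω) :
    Set.EqOn (derivAlong l (f + g)) (derivAlong l f + derivAlong l g) Ω := by
  induction l generalizing f g with
  | nil => exact fun _ _ => rfl
  | cons i l ih =>
    refine Set.EqOn.trans (derivAlong_congr hΩ l fun x hx => ?_)
      (ih (hf.fderiv_apply_const hΩ (Pi.single i 1)) (hg.fderiv_apply_const hΩ (Pi.single i 1)))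
    have hfx := (hf.contDiffAt (hΩ.mem_nhds hx)).differentiableAt (by simp)
    have hgx := (hg.contDiffAt (hΩ.mem_nhds hx)).differentiableAt (by simp)
    simp [fderiv_add hfx hgx]

/-- A Leibniz-type bound: a derivative of a product along `l` is controlled by the derivatives
of the factors along sublists of `l`. -/
theorem abs_derivAlong_mul_le {n : ℕ} {Ω : Set (Fin n → ℝ)} (hΩ : IsOpen Ω) {x : Fin n → ℝ}
    (hx : x ∈ Ω) {A B : ℝ} (l : List (Fin n)) {f g : (Fin n → ℝ) → ℝ}
    (hf : ContDiffOn ℝ (⊤ : ℕ∞) f Ω) (hg : ContDiffOn ℝ (⊤ : ℕ∞) g Ω)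
    (hA : ∀ l' : List (Fin n), l'.Sublist l → |derivAlong l' f x| ≤ A)
    (hB : ∀ l' : List (Fin n), l'.Sublist l → |derivAlong l' g x| ≤ B) :
    |derivAlong l (f * g) x| ≤ 2 ^ l.length * (A * B) := by
  induction l generalizing f g with
  | nil =>
    have h1 : |f x| ≤ A := hA [] (List.Sublist.refl _)
    have h2 : |g x| ≤ B := hB [] (List.Sublist.refl _)
    simpa [derivAlong, abs_mul] using
      mul_le_mul h1 h2 (abs_nonneg _) ((abs_nonneg _).trans h1)
  | cons i l ih =>
    have hf' := hf.fderiv_apply_const hΩ (Pi.single i 1)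
    have hg' := hg.fderiv_apply_const hΩ (Pi.single i 1)
    have key : derivAlong (i :: l) (f * g) x =
        derivAlong l ((fun y => fderiv ℝ f y (Pi.single i 1)) * g) x +
          derivAlong l (f * fun y => fderiv ℝ g y (Pi.single i 1)) x := by
      refine Eq.trans (derivAlong_congr hΩ l (fun y hy => ?_) hx)
        (derivAlong_add hΩ l (hf'.mul hg) (hf.mul hg') hx)
      have hfy := (hf.contDiffAt (hΩ.mem_nhds hy)).differentiableAt (by simp)
      have hgy := (hg.contDiffAt (hΩ.mem_nhds hy)).differentiableAt (by simp)
      simp [fderiv_mul hfy hgy]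
      ring
    have h1 := ih hf' hg (fun l' h => hA (i :: l') (h.cons_cons i))
      (fun l' h => hB l' (h.cons i))
    have h2 := ih hf hg' (fun l' h => hA l' (h.cons i))
      (fun l' h => hB (i :: l') (h.cons_cons i))
    rw [key, List.length_cons, pow_succ]
    linarith [abs_add_le (derivAlong l ((fun y => fderiv ℝ f y (Pi.single i 1)) * g) x)
      (derivAlong l (f * fun y => fderiv ℝ g y (Pi.single i 1)) x)]

theorem pairwise_le_flatMap_replicate {n : ℕ} (α : Fin n → ℕ) :
    ((List.finRange n).flatMap fun i => List.replicate (α i) i).Pairwise (· ≤ ·) := by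
  rw [List.pairwise_flatMap]
  refine ⟨fun i _ => by simp [List.pairwise_replicate], ?_⟩
  refine (List.pairwise_lt_finRange n).imp fun {i j} hij a ha b hb => ?_
  rw [List.eq_of_mem_replicate ha, List.eq_of_mem_replicate hb]
  exact hij.le

theorem flatMap_replicate_count {n : ℕ} {l : List (Fin n)} (hl : l.Pairwise (· ≤ ·)) :
    ((List.finRange n).flatMap fun i => List.replicate (l.count i) i) = l := by
  refine List.Perm.eq_of_pairwise' (pairwise_le_flatMap_replicate _) hl ?_
  rw [List.perm_iff_count]
  intro a
  rw [List.count_flatMap, ← Fin.sum_univ_def]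
  simp [List.count_replicate]

theorem length_flatMap_replicate {n : ℕ} (α : Fin n → ℕ) :
    ((List.finRange n).flatMap fun i => List.replicate (α i) i).length = ∑ i, α i := by
  simp [List.length_flatMap, Fin.sum_univ_def]

theorem exists_multiDeriv_eq_of_sublist {n : ℕ} (α : Fin n → ℕ) {l : List (Fin n)}
    (hl : l.Sublist ((List.finRange n).flatMap fun i => List.replicate (α i) i)) :
    ∃ β : Fin n → ℕ, ∑ i, β i ≤ ∑ i, α i ∧ ∀ f, derivAlong l f = multiDeriv β f := by
  have h := flatMap_replicate_count ((pairwise_le_flatMap_replicate α).sublist hl)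
  refine ⟨fun i => l.count i, ?_, fun f => by rw [multiDeriv, h]⟩
  rw [← length_flatMap_replicate, ← length_flatMap_replicate, h]
  exact hl.length_le

theorem Real.le_biSup_of_nonneg {ι : Type*} {s : Set ι} {F : ι → ℝ} (hF : ∀ i, 0 ≤ F i)
    (hs : BddAbove (F '' s)) {i : ι} (hi : i ∈ s) : F i ≤ ⨆ j ∈ s, F j := by
  obtain ⟨C, hC⟩ := hs
  have hb : BddAbove (Set.range fun j => ⨆ _ : j ∈ s, F j) := by
    refine ⟨C, ?_⟩
    rintro _ ⟨j, rfl⟩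
    exact Real.iSup_le (fun hj => hC ⟨j, hj, rfl⟩) ((hF i).trans (hC ⟨i, hi, rfl⟩))
  have := le_ciSup hb i
  simpa [hi] using this

theorem abs_multiDeriv_le_iSup {n : ℕ} {Ω : Set (Fin n → ℝ)} (hΩ : IsOpen Ω)
    {K : Set (Fin n → ℝ)} (hK : IsCompact K) (hKΩ : K ⊆ Ω) (m : ℕ) {f : (Fin n → ℝ) → ℝ}
    (hf : ContDiffOn ℝ (⊤ : ℕ∞) f Ω) {β : Fin n → ℕ} (hβ : ∑ i, β i ≤ m) {x : Fin n → ℝ}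
    (hx : x ∈ K) :
    |multiDeriv β f x| ≤
      ⨆ α ∈ {a : Fin n → ℕ | ∑ i, a i ≤ m}, ⨆ x ∈ K, |multiDeriv α f x| := by
  have hfin : {a : Fin n → ℕ | ∑ i, a i ≤ m}.Finite := by
    refine (Set.finite_Icc (0 : Fin n → ℕ) fun _ => m).subset fun a ha => ?_
    exact ⟨fun i => Nat.zero_le _, fun i =>
      (Finset.single_le_sum (fun _ _ => Nat.zero_le _) (Finset.mem_univ i)).trans ha⟩
  have hcont : ContinuousOn (fun x => |multiDeriv β f x|) K :=
    ((contDiffOn_derivAlong hΩ _ hf).continuousOn.mono hKΩ).abs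
  refine (Real.le_biSup_of_nonneg (F := fun x => |multiDeriv β f x|)
    (fun _ => abs_nonneg _) (hK.bddAbove_image hcont) hx).trans ?_
  exact Real.le_biSup_of_nonneg (F := fun α => ⨆ x ∈ K, |multiDeriv α f x|)
    (fun _ => Real.iSup_nonneg fun _ => Real.iSup_nonneg fun _ => abs_nonneg _)
    (hfin.image _).bddAbove hβ

/-- For `Ω ⊆ ℝ^p` open, `K ⊆ Ω` compact and `m ∈ ℕ`, the seminorm
`ρ_{K,m}(f) = 2^m · sup_{|α| ≤ m} sup_{x ∈ K} |∂^α f x|` on `C^∞(Ω)` is submultiplicative: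
`ρ_{K,m}(f·g) ≤ ρ_{K,m}(f) · ρ_{K,m}(g)`. -/
theorem smooth_seminorm_submultiplicative
    {p : ℕ} (Ω : Set (Fin p → ℝ)) (hΩ : IsOpen Ω)
    (K : Set (Fin p → ℝ)) (hK : IsCompact K) (hKΩ : K ⊆ Ω) (m : ℕ)
    (ρ : ((Fin p → ℝ) → ℝ) → ℝ)
    (hρ : ∀ f : (Fin p → ℝ) → ℝ,
      ρ f = 2 ^ m * ⨆ α ∈ {a : Fin p → ℕ | ∑ i, a i ≤ m}, ⨆ x ∈ K, |multiDeriv α f x|)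
    (f g : (Fin p → ℝ) → ℝ)
    (hf : ContDiffOn ℝ (⊤ : ℕ∞) f Ω) (hg : ContDiffOn ℝ (⊤ : ℕ∞) g Ω) :
    ρ (f * g) ≤ ρ f * ρ g := by
  rw [hρ, hρ, hρ]
  have hnonneg : ∀ h : (Fin p → ℝ) → ℝ,
      0 ≤ ⨆ α ∈ {a : Fin p → ℕ | ∑ i, a i ≤ m}, ⨆ x ∈ K, |multiDeriv α h x| := fun h =>
    Real.iSup_nonneg fun _ => Real.iSup_nonneg fun _ => Real.iSup_nonneg fun _ =>
      Real.iSup_nonneg fun _ => abs_nonneg _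
  have hbound := fun {h : (Fin p → ℝ) → ℝ} (hh : ContDiffOn ℝ (⊤ : ℕ∞) h Ω) {β : Fin p → ℕ}
    (hβ : ∑ i, β i ≤ m) {x : Fin p → ℝ} (hx : x ∈ K) =>
      abs_multiDeriv_le_iSup hΩ hK hKΩ m hh hβ hx
  have hAnn := hnonneg f
  have hBnn := hnonneg g
  have hA := @hbound f hf
  have hB := @hbound g hg
  generalize (⨆ α ∈ {a : Fin p → ℕ | ∑ i, a i ≤ m}, ⨆ x ∈ K, |multiDeriv α f x|) = A at *
  generalize (⨆ α ∈ {a : Fin p → ℕ | ∑ i, a i ≤ m}, ⨆ x ∈ K, |multiDeriv α g x|) = B at *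
  have hC : 0 ≤ 2 ^ m * (A * B) := by positivity
  rw [show 2 ^ m * A * (2 ^ m * B) = 2 ^ m * (2 ^ m * (A * B)) by ring]
  refine mul_le_mul_of_nonneg_left ?_ (by positivity)
  refine Real.iSup_le (fun α => Real.iSup_le (fun hα => Real.iSup_le (fun x =>
    Real.iSup_le (fun hx => ?_) hC) hC) hC) hC
  have hα' : ∑ i, α i ≤ m := hα
  refine (abs_derivAlong_mul_le (A := A) (B := B) hΩ (hKΩ hx) _ hf hg ?_ ?_).trans ?_
  · intro l hl
    obtain ⟨β, hβ, h⟩ := exists_multiDeriv_eq_of_sublist α hl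
    rw [h]
    exact hA (hβ.trans hα') hx
  · intro l hl
    obtain ⟨β, hβ, h⟩ := exists_multiDeriv_eq_of_sublist α hl
    rw [h]
    exact hB (hβ.trans hα') hx
  · rw [length_flatMap_replicate]
    gcongr
    norm_num
end

section
/- Let A be a commutative unital ℝ-algebra, let J ⊆ A be an ideal, let k ∈ ℕ, and let D : A → A be an ℝ-linear map which is a differential operator of order ≤ k, in the sense that for all f_0, f_1, …, f_k ∈ A the iterated commutator [⋯[[D, L_{f_0}], L_{f_1}], ⋯, L_{f_k}] = 0, where L_f : A → A denotes multiplication by f and [T, L_f] = T∘L_f − L_f∘T. Then D(J^{k+c}) ⊆ J^c for every integer c ≥ 1. -/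
/-- If all `n`-fold iterated commutators of `D` with multiplication operators vanish, then `D` maps
`J ^ (n + c)` into `J ^ (c + 1)`. -/
theorem map_mem_pow_succ_of_foldl_commutator_eq_zero
    {R A : Type*} [CommRing R] [CommRing A] [Algebra R A] (J : Ideal A) (n : ℕ) (D : A →ₗ[R] A)
    (hD : ∀ l : List A, l.length = n →
      l.foldl (fun T a => T ∘ₗ LinearMap.mulLeft R a - LinearMap.mulLeft R a ∘ₗ T) D = 0)
    (c : ℕ) {x : A} (hx : x ∈ J ^ (n + c)) : D x ∈ J ^ (c + 1) := by
  induction n generalizing D c x with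
  | zero =>
    have hD0 : D = 0 := hD [] rfl
    simp [hD0]
  | succ n ihn =>
    have commutator_mem (a : A) (c : ℕ) {y : A} (hy : y ∈ J ^ (n + c)) :
        D (a * y) - a * D y ∈ J ^ (c + 1) :=
      ihn (D ∘ₗ LinearMap.mulLeft R a - LinearMap.mulLeft R a ∘ₗ D)
        (fun l hl => hD (a :: l) (by simp [hl])) c hy
    induction c generalizing x with
    | zero =>
      rw [show n + 1 + 0 = (n + 0) + 1 by omega, pow_succ'] at hx
      refine Submodule.mul_induction_on hx (fun a ha y hy => ?_) fun y z hy hz => ?_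
      · rw [← sub_add_cancel (D (a * y)) (a * D y)]
        exact add_mem (commutator_mem a 0 hy) (by simpa using J.mul_mem_right _ ha)
      · rw [map_add]
        exact add_mem hy hz
    | succ c ihc =>
      rw [show n + 1 + (c + 1) = (n + (c + 1)) + 1 by omega, pow_succ'] at hx
      refine Submodule.mul_induction_on hx (fun a ha y hy => ?_) fun y z hy hz => ?_
      · rw [← sub_add_cancel (D (a * y)) (a * D y)]
        refine add_mem (commutator_mem a (c + 1) hy) ?_
        rw [pow_succ' J (c + 1)]
        exact Ideal.mul_mem_mul ha (ihc (by rwa [show n + 1 + c = n + (c + 1) by omega]))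
      · rw [map_add]
        exact add_mem hy hz


/-- Let `A` be a commutative unital `ℝ`-algebra, `J ⊆ A` an ideal, `k ∈ ℕ`,
and `D : A → A` an `ℝ`-linear differential operator of order `≤ k`, i.e. all `(k+1)`-fold
iterated commutators `[⋯[[D, L_{f₀}], L_{f₁}], ⋯, L_{f_k}]` with multiplication operators
vanish. Then `D(J^{k+c}) ⊆ J^c` for every `c ≥ 1`. -/
theorem diffOp_maps_ideal_power_into_ideal_power
    {A : Type*} [CommRing A] [Algebra ℝ A]
    (J : Ideal A) (k : ℕ) (D : A →ₗ[ℝ] A)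
    (hD : ∀ f : Fin (k + 1) → A,
      (List.ofFn f).foldl
        (fun T a => T ∘ₗ LinearMap.mulLeft ℝ a - LinearMap.mulLeft ℝ a ∘ₗ T) D = 0) :
    ∀ c : ℕ, 1 ≤ c → ∀ x ∈ J ^ (k + c), D x ∈ J ^ c := by
  intro c hc x hx
  obtain ⟨c, rfl⟩ := Nat.exists_eq_add_of_le' hc
  refine map_mem_pow_succ_of_foldl_commutator_eq_zero J (k + 1) D (fun l hl => ?_) c
    (by rwa [show k + 1 + c = k + (c + 1) by omega])
  have h := hD fun i => l.get (i.cast hl.symm)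
  rwa [← List.ofFn_congr hl l.get, List.ofFn_get] at h
end

section
/- Let A be a commutative unital ℝ-algebra, let J ⊆ A be an ideal, let k ∈ ℕ, and let D : A → A be an ℝ-linear map such that for all f_0, f_1, …, f_k ∈ A the iterated commutator [⋯[[D, L_{f_0}], L_{f_1}], ⋯, L_{f_k}] = 0, where L_f denotes multiplication by f. Then D is continuous with respect to the J-adic topology on A, i.e., the topology in which the cosets x + J^c (c ∈ ℕ) form a neighborhood basis of each point x ∈ A. In particular, if a sequence (f_n) in A converges J-adically to f ∈ A, then D(f_n) converges J-adically to D(f). -/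
/-- If all `n`-fold iterated commutators of `D` with multiplication operators vanish, then `D`
maps `J ^ (c + n)` into `J ^ c`. -/
theorem map_mem_pow_of_foldl_commutator_eq_zero {R A : Type*} [CommRing R] [CommRing A]
    [Algebra R A] (J : Ideal A) (n : ℕ) (D : A →ₗ[R] A)
    (hD : ∀ l : List A, l.length = n →
      l.foldl (fun T a => T ∘ₗ LinearMap.mulLeft R a - LinearMap.mulLeft R a ∘ₗ T) D = 0)
    (c : ℕ) {x : A} (hx : x ∈ J ^ (c + n)) : D x ∈ J ^ c := by
  induction n generalizing D c x with
  | zero =>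
    have hzero : D = 0 := hD [] rfl
    simp [hzero]
  | succ n ihn =>
    induction c generalizing x with
    | zero => simp
    | succ c ihc =>
      rw [show c + 1 + (n + 1) = (c + (n + 1)) + 1 by ring, pow_succ'] at hx
      induction hx using Submodule.mul_induction_on' with
      | mem_mul_mem a ha g hg =>
        have hcomm := ihn (D ∘ₗ LinearMap.mulLeft R a - LinearMap.mulLeft R a ∘ₗ D)
          (fun l hl => hD (a :: l) (by simp [hl])) (c + 1) (x := g)
          (by rwa [show c + 1 + n = c + (n + 1) by ring])
        have hmul : a * D g ∈ J ^ (c + 1) := by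
          rw [pow_succ']
          exact Ideal.mul_mem_mul ha (ihc hg)
        simpa using add_mem hcomm hmul
      | add x _ y _ hx hy =>
        rw [map_add]
        exact add_mem hx hy

/-- Let `A` be a commutative unital `ℝ`-algebra, `J ⊆ A` an ideal, `k ∈ ℕ`,
and `D : A → A` an `ℝ`-linear map all of whose `(k+1)`-fold iterated commutators with
multiplication operators vanish. Then `D` is continuous for the `J`-adic topology on `A`;
in particular, if a sequence `(f m)` converges `J`-adically to `g`, then `(D (f m))` converges
`J`-adically to `D g`. -/
theorem diffOp_continuous_adicTopology
    {A : Type*} [CommRing A] [Algebra ℝ A]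
    (J : Ideal A) (k : ℕ) (D : A →ₗ[ℝ] A)
    (hD : ∀ f : Fin (k + 1) → A,
      (List.ofFn f).foldl
        (fun T a => T ∘ₗ LinearMap.mulLeft ℝ a - LinearMap.mulLeft ℝ a ∘ₗ T) D = 0) :
    @Continuous A A J.adicTopology J.adicTopology D ∧
    (∀ (f : ℕ → A) (g : A),
      (∀ c : ℕ, ∃ N : ℕ, ∀ m ≥ N, f m - g ∈ J ^ c) →
      ∀ c : ℕ, ∃ N : ℕ, ∀ m ≥ N, D (f m) - D g ∈ J ^ c) := by
  have hpow (c : ℕ) {x : A} (hx : x ∈ J ^ (c + (k + 1))) : D x ∈ J ^ c := by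
    refine map_mem_pow_of_foldl_commutator_eq_zero J (k + 1) D (fun l hl => ?_) c hx
    have hl' := hD (fun i => l.get (i.cast hl.symm))
    rwa [show List.ofFn (fun i => l.get (i.cast hl.symm)) = l from
      List.ext_getElem (by simp [hl]) (by simp [-List.ofFn_succ])] at hl'
  refine ⟨?_, fun f g hf c => ?_⟩
  · let _ := J.adicTopology
    refine continuous_iff_continuousAt.2 fun x => ?_
    refine ((J.hasBasis_nhds_adic x).tendsto_iff (J.hasBasis_nhds_adic (D x))).2 fun c _ =>
      ⟨c + (k + 1), trivial, ?_⟩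
    rintro _ ⟨y, hy, rfl⟩
    exact ⟨D y, hpow c hy, (map_add D x y).symm⟩
  · obtain ⟨N, hN⟩ := hf (c + (k + 1))
    refine ⟨N, fun m hm => ?_⟩
    rw [← map_sub]
    exact hpow c (hN m hm)
end
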